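/- Fix integers n ≥ 1 and k₁, k₂ ≥ 0. Then there exist constants K > 0, κ₀ > 0 and T₀ > 0 such that for all (x, t) ∈ ℝ^{2n} × ℝ with t ≠ 0, κ ≤ κ₀ and |t| ≥ T₀, one has |p_{1,k₁,k₂}(x,t) − P(x,t)| ≤ K |P(x,t)| (1/|t| + κ), where P(x,t) = ((−1)^{k₂} π^{k₁+k₂} / (4ⁿ (n+k₁−1)!)) · |t|^{n+k₁−1} · e^{−d(x,t)²/4}. -/

import Mathlib

open Real Complex MeasureTheory
open scoped Classical

/-- θ(y) = (2y − sin(2y))/(2 sin²(y)) for y ≠ 0, θ(0) = 0. -/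
noncomputable def theta (y : ℝ) : ℝ :=
  if y = 0 then 0 else (2 * y - Real.sin (2 * y)) / (2 * Real.sin y ^ 2)

/-- The radial derivative p_{1,k₁,k₂} of the heat kernel at time 1 on the Heisenberg
group ℍⁿ, with R = |x|²/4 (integrand extended by continuity at λ = 0). -/
noncomputable def pH (n k₁ k₂ : ℕ) (x : EuclideanSpace ℝ (Fin (2 * n))) (t : ℝ) : ℂ :=
  (2 * (-1 : ℂ) ^ k₁ * Complex.I ^ k₂ / (4 * (π : ℂ)) ^ (n + 1)) *
    ∫ lam : ℝ,
      if lam = 0 then (if k₂ = 0 then Complex.exp (-((‖x‖ ^ 2 / 4 : ℝ) : ℂ)) else 0)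
      else
        Complex.exp (Complex.I * (lam : ℂ) * (|t| : ℝ)
            - ((‖x‖ ^ 2 / 4 * lam * Real.cosh lam / Real.sinh lam : ℝ) : ℂ)) *
          ((lam : ℂ) ^ (n + k₁ + k₂) * ((Real.cosh lam : ℝ) : ℂ) ^ k₁
            / ((Real.sinh lam : ℝ) : ℂ) ^ (n + k₁))

open Filter Topology

/-- The integral of a holomorphic function along a horizontal line does not change when the line is
moved inside a strip on which the function decays quadratically. -/
theorem integral_horizontal_line_eq {f : ℂ → ℂ} {b C : ℝ} (hb : 0 ≤ b)
    (hf : DifferentiableOn ℂ f {z | 0 ≤ z.im ∧ z.im ≤ b})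
    (hC : ∀ z : ℂ, 0 ≤ z.im → z.im ≤ b → ‖f z‖ ≤ C * (1 + z.re ^ 2)⁻¹) :
    ∫ x : ℝ, f x = ∫ x : ℝ, f (x + b * Complex.I) := by
  have hint : ∀ y : ℝ, 0 ≤ y → y ≤ b → Integrable fun x : ℝ => f (x + y * Complex.I) := by
    intro y hy hyb
    refine (integrable_inv_one_add_sq.const_mul C).mono' ?_ ?_
    · refine Continuous.aestronglyMeasurable ?_
      refine hf.continuousOn.comp_continuous (by fun_prop) ?_
      intro x
      simp [hy, hyb]
    · refine Filter.Eventually.of_forall fun x => ?_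
      simpa using hC (x + y * Complex.I) (by simpa using hy) (by simpa using hyb)
  have h0 : Integrable fun x : ℝ => f (x + (0 : ℝ) * Complex.I) := hint 0 le_rfl hb
  have hB := hint b hb le_rfl
  have ht0 := intervalIntegral_tendsto_integral h0 tendsto_neg_atTop_atBot tendsto_id
  have htB := intervalIntegral_tendsto_integral hB tendsto_neg_atTop_atBot tendsto_id
  have hC0 : 0 ≤ C := by
    have := (norm_nonneg _).trans (hC 0 (by simp) (by simpa using hb))
    simpa using this
  have side : ∀ r : ℝ, ‖∫ y in (0 : ℝ)..b, f (r + y * Complex.I)‖ ≤ C * (1 + r ^ 2)⁻¹ * b := by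
    intro r
    have := intervalIntegral.norm_integral_le_of_norm_le_const (a := (0 : ℝ)) (b := b)
      (f := fun y : ℝ => f (r + y * Complex.I)) (C := C * (1 + r ^ 2)⁻¹) ?_
    · simpa [abs_of_nonneg hb] using this
    · intro y hy
      rw [Set.uIoc_of_le hb] at hy
      simpa using hC (r + y * Complex.I) (by simpa using hy.1.le) (by simpa using hy.2)
  have hlim : Tendsto (fun r : ℝ => C * (1 + r ^ 2)⁻¹ * b + C * (1 + r ^ 2)⁻¹ * b) atTop (𝓝 0) := by
    have h1 : Tendsto (fun r : ℝ => (1 + r ^ 2)⁻¹) atTop (𝓝 0) :=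
      tendsto_inv_atTop_zero.comp
        (tendsto_atTop_add_const_left _ _ (tendsto_pow_atTop two_ne_zero))
    simpa using ((h1.const_mul C).mul_const b).add ((h1.const_mul C).mul_const b)
  have hdiff : Tendsto (fun r : ℝ => (∫ x in (-r)..r, f (x + (0 : ℝ) * Complex.I)) -
      ∫ x in (-r)..r, f (x + b * Complex.I)) atTop (𝓝 0) := by
    refine squeeze_zero_norm (fun r => ?_) hlim
    have hrect := Complex.integral_boundary_rect_eq_zero_of_differentiableOn f
      ((-r : ℝ) : ℂ) ((r : ℂ) + b * Complex.I) (hf.mono ?_)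
    · have e : (∫ x in (-r)..r, f (x + (0 : ℝ) * Complex.I)) -
          ∫ x in (-r)..r, f (x + b * Complex.I) =
          Complex.I * (∫ y in (0 : ℝ)..b, f (((-r : ℝ) : ℂ) + y * Complex.I)) -
          Complex.I * ∫ y in (0 : ℝ)..b, f ((r : ℂ) + y * Complex.I) := by
        simp only [Complex.ofReal_re, Complex.ofReal_im, Complex.add_re, Complex.add_im,
          Complex.mul_re, Complex.mul_im, Complex.I_re, Complex.I_im, mul_zero, mul_one,
          sub_zero, add_zero, zero_add, smul_eq_mul] at hrect
        linear_combination hrect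
      rw [e]
      refine (norm_sub_le _ _).trans ?_
      rw [norm_mul, norm_mul, Complex.norm_I, one_mul, one_mul]
      refine add_le_add ?_ (side r)
      simpa using side (-r)
    · intro z hz
      have := hz.2
      simp only [Set.mem_preimage] at this
      simpa [Set.uIcc_of_le hb] using this
  have := tendsto_nhds_unique hdiff (ht0.sub htB)
  have := sub_eq_zero.mp this.symm
  simpa using this

/-- Absolute integrability of the Laplace transform of a monomial. -/
theorem integrableOn_pow_mul_cexp_neg_mul (j : ℕ) {w : ℂ} (hw : 0 < w.re) :
    IntegrableOn (fun s : ℝ => (s : ℂ) ^ j * Complex.exp (-w * s)) (Set.Ioi 0) := by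
  have h := integrableOn_rpow_mul_exp_neg_mul_rpow (p := 1) (s := j) (b := w.re)
    (by have : (0 : ℝ) ≤ j := j.cast_nonneg
        linarith) one_pos hw
  refine Integrable.mono' h (by fun_prop) ?_
  filter_upwards [ae_restrict_mem measurableSet_Ioi] with s hs
  have hs' : (0 : ℝ) < s := hs
  simp [Complex.norm_exp, abs_of_pos hs']

/-- The Laplace transform of a monomial. -/
theorem integral_pow_mul_cexp_neg_mul_Ioi (j : ℕ) {w : ℂ} (hw : 0 < w.re) :
    ∫ s in Set.Ioi (0 : ℝ), (s : ℂ) ^ j * Complex.exp (-w * s) = j.factorial * w⁻¹ ^ (j + 1) := by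
  have hw0 : w ≠ 0 := by
    rintro rfl
    simp at hw
  induction j with
  | zero =>
    have := integral_exp_mul_complex_Ioi (a := -w) (by simpa using hw) 0
    simpa using this
  | succ j ih =>
    have hderiv : ∀ s ∈ Set.Ici (0 : ℝ), HasDerivAt
        (fun s : ℝ => -((s : ℂ) ^ (j + 1) * Complex.exp (-w * s) / w))
        ((s : ℂ) ^ (j + 1) * Complex.exp (-w * s)
          - (j + 1) / w * ((s : ℂ) ^ j * Complex.exp (-w * s))) s := by
      intro s _
      have h1 : HasDerivAt (fun s : ℝ => (s : ℂ)) 1 s := Complex.ofRealCLM.hasDerivAt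
      have h3 := (((h1.pow (j + 1)).mul ((h1.const_mul (-w)).cexp)).div_const w).neg
      refine HasDerivAt.congr_deriv h3 ?_
      simp
      field_simp
      ring
    have hi1 := integrableOn_pow_mul_cexp_neg_mul (j + 1) hw
    have hi2 := (integrableOn_pow_mul_cexp_neg_mul j hw).const_mul ((j + 1) / w)
    have hlim : Tendsto (fun s : ℝ => -((s : ℂ) ^ (j + 1) * Complex.exp (-w * s) / w))
        atTop (𝓝 0) := by
      have h := tendsto_rpow_mul_exp_neg_mul_atTop_nhds_zero (j + 1 : ℕ) w.re hw
      have h' := h.div_const ‖w‖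
      rw [zero_div] at h'
      refine squeeze_zero_norm' ?_ h'
      filter_upwards [eventually_gt_atTop 0] with s hs
      rw [Real.rpow_natCast]
      simp [Complex.norm_exp, abs_of_pos hs]
    have key := integral_Ioi_of_hasDerivAt_of_tendsto' hderiv (hi1.sub hi2) hlim
    rw [integral_sub hi1 hi2, integral_const_mul, ih] at key
    simp only [Complex.ofReal_zero, ne_eq, Nat.add_eq_zero_iff, one_ne_zero, and_false,
      not_false_eq_true, zero_pow, zero_mul, zero_div, neg_zero, sub_zero] at key
    rw [sub_eq_zero.mp key, Nat.factorial_succ]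
    push_cast
    ring

/-- Differences of inverse powers decay quadratically. -/
theorem norm_inv_pow_sub_inv_pow_le {x y : ℂ} {r : ℝ} (hr : 1 ≤ r) (hx : r ≤ ‖x‖) (hy : r ≤ ‖y‖)
    (m : ℕ) : ‖x⁻¹ ^ m - y⁻¹ ^ m‖ ≤ m * (‖y - x‖ * (r ^ 2)⁻¹) := by
  have r0 : 0 < r := by linarith
  have hx0 : x ≠ 0 := norm_pos_iff.mp (by linarith)
  have hy0 : y ≠ 0 := norm_pos_iff.mp (by linarith)
  have hx1 : ‖x⁻¹‖ ≤ 1 := by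
    rw [norm_inv]
    exact inv_le_one_of_one_le₀ (hr.trans hx)
  have hy1 : ‖y⁻¹‖ ≤ 1 := by
    rw [norm_inv]
    exact inv_le_one_of_one_le₀ (hr.trans hy)
  have hd : ‖x⁻¹ - y⁻¹‖ ≤ ‖y - x‖ * (r ^ 2)⁻¹ := by
    rw [inv_sub_inv hx0 hy0, norm_div, norm_mul, div_eq_mul_inv]
    gcongr
    nlinarith
  induction m with
  | zero => simp
  | succ m ih =>
    have e : x⁻¹ ^ (m + 1) - y⁻¹ ^ (m + 1) =
        x⁻¹ ^ m * (x⁻¹ - y⁻¹) + (x⁻¹ ^ m - y⁻¹ ^ m) * y⁻¹ := by ring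
    rw [e]
    refine (norm_add_le _ _).trans ?_
    rw [norm_mul, norm_mul, norm_pow]
    have h1 : ‖x⁻¹‖ ^ m ≤ 1 := pow_le_one₀ (norm_nonneg _) hx1
    have h2 := mul_le_mul h1 hd (norm_nonneg _) zero_le_one
    have h3 := mul_le_mul ih hy1 (norm_nonneg _) ((norm_nonneg _).trans ih)
    push_cast
    linarith

theorem integrable_inv_pow_sub_inv_pow {a b : ℝ} (ha : 1 ≤ a) (hb : 1 ≤ b) (m : ℕ) :
    Integrable fun u : ℝ => (a + Complex.I * u)⁻¹ ^ m - (b + Complex.I * u : ℂ)⁻¹ ^ m := by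
  have hne : ∀ c : ℝ, 1 ≤ c → ∀ u : ℝ, (c + Complex.I * u : ℂ) ≠ 0 := by
    intro c hc u h
    have := congrArg Complex.re h
    simp at this
    linarith
  have hle : ∀ c : ℝ, 1 ≤ c → ∀ u : ℝ, √(1 + u ^ 2) ≤ ‖(c + Complex.I * u : ℂ)‖ := by
    intro c hc u
    refine Real.sqrt_le_iff.mpr ⟨norm_nonneg _, ?_⟩
    rw [← Complex.normSq_eq_norm_sq, Complex.normSq_apply]
    simp
    nlinarith
  refine (integrable_inv_one_add_sq.const_mul (m * |b - a|)).mono' ?_ ?_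
  · refine Continuous.aestronglyMeasurable ?_
    exact ((Continuous.inv₀ (by fun_prop) (hne a ha)).pow m).sub
      ((Continuous.inv₀ (by fun_prop) (hne b hb)).pow m)
  · refine Filter.Eventually.of_forall fun u => ?_
    have h1 : 1 ≤ √(1 + u ^ 2) := Real.one_le_sqrt.mpr (by nlinarith [sq_nonneg u])
    have := norm_inv_pow_sub_inv_pow_le h1 (hle a ha u) (hle b hb u) m
    rw [Real.sq_sqrt (by positivity)] at this
    have e : (b + Complex.I * u : ℂ) - (a + Complex.I * u) = ((b - a : ℝ) : ℂ) := by
      push_cast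
      ring
    rw [e, Complex.norm_real, Real.norm_eq_abs] at this
    linarith

/-- Fourier inversion for a difference of two gamma densities. -/
theorem integral_cexp_mul_inv_pow_sub_inv_pow {a b T : ℝ} (ha : 1 ≤ a) (hb : 1 ≤ b) (hT : 0 < T)
    (j : ℕ) :
    ∫ u : ℝ, Complex.exp (Complex.I * u * T) *
      ((a + Complex.I * u)⁻¹ ^ (j + 1) - (b + Complex.I * u : ℂ)⁻¹ ^ (j + 1)) =
      2 * π * T ^ j * (Real.exp (-a * T) - Real.exp (-b * T) : ℝ) / j.factorial := by
  set g : ℝ → ℂ := fun s => (s : ℂ) ^ j * Complex.exp (-(a : ℂ) * s)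
    - (s : ℂ) ^ j * Complex.exp (-(b : ℂ) * s) with hg
  set f : ℝ → ℂ := (Set.Ioi (0 : ℝ)).indicator g with hf
  have hfi : Integrable f := by
    rw [hf, integrable_indicator_iff measurableSet_Ioi]
    exact (integrableOn_pow_mul_cexp_neg_mul j (by simp; linarith)).sub
      (integrableOn_pow_mul_cexp_neg_mul j (by simp; linarith))
  set M : ℝ → ℂ := fun u => (a + Complex.I * u)⁻¹ ^ (j + 1)
    - (b + Complex.I * u : ℂ)⁻¹ ^ (j + 1) with hM
  have hF : FourierTransform.fourier f = fun ξ : ℝ => (j.factorial : ℂ) * M (2 * π * ξ) := by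
    ext ξ
    rw [Real.fourier_eq']
    have e1 : ∀ v : ℝ, Complex.exp (↑(-2 * π * inner ℝ v ξ) * Complex.I) • f v =
        (Set.Ioi (0 : ℝ)).indicator (fun s : ℝ =>
          (s : ℂ) ^ j * Complex.exp (-(a + Complex.I * (2 * π * ξ : ℝ)) * s)
          - (s : ℂ) ^ j * Complex.exp (-(b + Complex.I * (2 * π * ξ : ℝ)) * s)) v := by
      intro v
      by_cases hv : v ∈ Set.Ioi (0 : ℝ)
      · rw [hf, Set.indicator_of_mem hv, Set.indicator_of_mem hv, hg, smul_eq_mul]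
        simp only [mul_sub, mul_left_comm _ ((v : ℂ) ^ j), ← Complex.exp_add]
        congr 3 <;>
        · simp
          ring
      · rw [hf, Set.indicator_of_notMem hv, Set.indicator_of_notMem hv, smul_zero]
    simp_rw [e1]
    rw [integral_indicator measurableSet_Ioi, integral_sub, integral_pow_mul_cexp_neg_mul_Ioi,
      integral_pow_mul_cexp_neg_mul_Ioi, hM]
    · push_cast
      ring
    · simp
      linarith
    · simp
      linarith
    · exact integrableOn_pow_mul_cexp_neg_mul j (by simp; linarith)
    · exact integrableOn_pow_mul_cexp_neg_mul j (by simp; linarith)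
  have hFi : Integrable (FourierTransform.fourier f) := by
    rw [hF]
    exact ((integrable_inv_pow_sub_inv_pow ha hb (j + 1)).comp_mul_left'
      (R := 2 * π) (by positivity)).const_mul _
  have hcont : ContinuousAt f T := by
    have : f =ᶠ[𝓝 T] g := by
      filter_upwards [lt_mem_nhds hT] with s hs
      rw [hf, Set.indicator_of_mem (Set.mem_Ioi.mpr hs)]
    refine ContinuousAt.congr ?_ this.symm
    fun_prop
  have inv := hfi.fourierInv_fourier_eq hFi hcont
  rw [hF, Real.fourierInv_eq'] at inv
  have e2 : ∀ v : ℝ, Complex.exp (↑(2 * π * inner ℝ v T) * Complex.I) •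
      ((j.factorial : ℂ) * M (2 * π * v)) = (j.factorial : ℂ) *
      (fun u : ℝ => Complex.exp (Complex.I * u * T) * M u) (2 * π * v) := by
    intro v
    simp only [smul_eq_mul]
    rw [mul_left_comm]
    congr 3
    simp
    ring
  simp_rw [e2] at inv
  rw [integral_const_mul, Measure.integral_comp_mul_left
    (fun u : ℝ => Complex.exp (Complex.I * u * T) * M u) (2 * π), hf,
    Set.indicator_of_mem (Set.mem_Ioi.mpr hT), hg, abs_of_pos (by positivity)] at inv
  have hpi : (π : ℂ) ≠ 0 := by exact_mod_cast Real.pi_ne_zero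
  have hj : (j.factorial : ℂ) ≠ 0 := by exact_mod_cast j.factorial_ne_zero
  rw [eq_div_iff hj]
  change (∫ u : ℝ, Complex.exp (Complex.I * u * T) * M u) * _ = _
  generalize (∫ u : ℝ, Complex.exp (Complex.I * u * T) * M u) = J at inv ⊢
  simp only [Complex.real_smul] at inv
  push_cast at inv ⊢
  field_simp at inv ⊢
  linear_combination inv

/-- The entire function `sinh z / z`. -/
noncomputable def sinhDiv : ℂ → ℂ := dslope Complex.sinh 0

/-- The entire function `sinh z / (z (z - π i))`. -/
noncomputable def sinhDivDiv : ℂ → ℂ := dslope sinhDiv (π * Complex.I)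

theorem differentiable_dslope_complex {f : ℂ → ℂ} (hf : Differentiable ℂ f) (c : ℂ) :
    Differentiable ℂ (dslope f c) :=
  differentiableOn_univ.mp
    ((Complex.differentiableOn_dslope Filter.univ_mem).mpr hf.differentiableOn)

theorem differentiable_sinhDiv : Differentiable ℂ sinhDiv :=
  differentiable_dslope_complex Complex.differentiable_sinh 0

theorem differentiable_sinhDivDiv : Differentiable ℂ sinhDivDiv :=
  differentiable_dslope_complex differentiable_sinhDiv _

theorem mul_sinhDiv (z : ℂ) : z * sinhDiv z = Complex.sinh z := by
  simpa [sinhDiv] using sub_smul_dslope Complex.sinh 0 z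

theorem sinhDiv_pi_mul_I : sinhDiv (π * Complex.I) = 0 := by
  have h := mul_sinhDiv (π * Complex.I)
  rw [Complex.sinh_mul_I, Complex.sin_pi, zero_mul] at h
  refine (mul_eq_zero.mp h).resolve_left ?_
  simp [Real.pi_ne_zero]

theorem sub_mul_sinhDivDiv (z : ℂ) : (z - π * Complex.I) * sinhDivDiv z = sinhDiv z := by
  simpa [sinhDivDiv, sinhDiv_pi_mul_I] using sub_smul_dslope sinhDiv (π * Complex.I) z

theorem mul_sub_mul_sinhDivDiv (z : ℂ) :
    z * (z - π * Complex.I) * sinhDivDiv z = Complex.sinh z := by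
  rw [mul_assoc, sub_mul_sinhDivDiv, mul_sinhDiv]

theorem sinhDivDiv_pi_mul_I : sinhDivDiv (π * Complex.I) = Complex.I / π := by
  have h0 : (π : ℂ) ≠ 0 := by exact_mod_cast Real.pi_ne_zero
  have h1 : HasDerivAt (fun z => z * sinhDiv z)
      (1 * sinhDiv (π * Complex.I) + π * Complex.I * deriv sinhDiv (π * Complex.I))
      (π * Complex.I) :=
    (hasDerivAt_id _).mul (differentiable_sinhDiv _).hasDerivAt
  rw [funext mul_sinhDiv] at h1
  have h2 := h1.unique (Complex.hasDerivAt_sinh (π * Complex.I))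
  rw [sinhDiv_pi_mul_I, Complex.cosh_mul_I, Complex.cos_pi] at h2
  rw [sinhDivDiv, dslope_same]
  rw [eq_div_iff h0]
  linear_combination (-Complex.I) * h2 + π * deriv sinhDiv (π * Complex.I) * Complex.I_sq

theorem sinhDivDiv_ne_zero {z : ℂ} (h1 : -π < z.im) (h2 : z.im < 2 * π) : sinhDivDiv z ≠ 0 := by
  intro h
  have hs : Complex.sinh z = 0 := by rw [← mul_sub_mul_sinhDivDiv, h, mul_zero]
  have hsin : Complex.sin (z * Complex.I) = 0 := by rw [Complex.sin_mul_I, hs, zero_mul]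
  obtain ⟨k, hk⟩ := Complex.sin_eq_zero_iff.mp hsin
  have hz : z = -(k * π * Complex.I) := by
    linear_combination (-Complex.I) * hk + z * Complex.I_sq
  have him : z.im = -(k * π) := by
    rw [hz]
    simp
  rw [him] at h1 h2
  have hp := Real.pi_pos
  have hk1 : (k : ℝ) < 1 := by nlinarith
  have hk2 : (-2 : ℝ) < k := by nlinarith
  have hk1' : k < 1 := by exact_mod_cast hk1
  have hk2' : -2 < k := by exact_mod_cast hk2
  have h01 : k = 0 ∨ k = -1 := by omega
  have h0 : (π : ℂ) ≠ 0 := by exact_mod_cast Real.pi_ne_zero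
  rcases h01 with rfl | rfl
  · have hz0 : z = 0 := by simpa using hz
    have h3 := sub_mul_sinhDivDiv z
    rw [h, mul_zero, hz0, sinhDiv, dslope_same, Complex.deriv_sinh, Complex.cosh_zero] at h3
    exact zero_ne_one h3
  · have hz0 : z = π * Complex.I := by
      rw [hz]
      push_cast
      ring
    rw [hz0, sinhDivDiv_pi_mul_I] at h
    simp [h0] at h

theorem norm_complex_cosh_le (z : ℂ) : ‖Complex.cosh z‖ ≤ Real.exp |z.re| := by
  rw [Complex.cosh, norm_div, Complex.norm_ofNat]
  have h := norm_add_le (Complex.exp z) (Complex.exp (-z))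
  rw [Complex.norm_exp, Complex.norm_exp, Complex.neg_re] at h
  have h1 := Real.exp_le_exp.mpr (le_abs_self z.re)
  have h2 := Real.exp_le_exp.mpr (neg_le_abs z.re)
  linarith

theorem exp_abs_re_le_norm_sinh {z : ℂ} (hz : 1 ≤ |z.re|) :
    Real.exp |z.re| / 4 ≤ ‖Complex.sinh z‖ := by
  rw [Complex.sinh, norm_div, Complex.norm_ofNat]
  have h := abs_norm_sub_norm_le (Complex.exp z) (Complex.exp (-z))
  rw [Complex.norm_exp, Complex.norm_exp, Complex.neg_re] at h
  have h1 : Real.exp |z.re| - Real.exp (-|z.re|) ≤ |Real.exp z.re - Real.exp (-z.re)| := by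
    rcases abs_cases z.re with ⟨e, _⟩ | ⟨e, _⟩
    · rw [e]
      exact le_abs_self _
    · rw [e, neg_neg, abs_sub_comm]
      exact le_abs_self _
  have h2 : Real.exp (-|z.re|) ≤ 1 := Real.exp_le_one_iff.mpr (by linarith)
  have h3 : 2 ≤ Real.exp |z.re| := by
    have := Real.add_one_le_exp |z.re|
    linarith
  linarith

theorem norm_le_of_mem_strip {z : ℂ} (h0 : 0 ≤ z.im) (h1 : z.im ≤ π + 1) :
    ‖z‖ ≤ 5 * (1 + |z.re|) := by
  have := Complex.norm_le_abs_re_add_abs_im z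
  rw [abs_of_nonneg h0] at this
  have := Real.pi_lt_four
  have := abs_nonneg z.re
  linarith

theorem exists_le_norm_sinhDivDiv : ∃ c > 0, ∀ z : ℂ, 0 ≤ z.im → z.im ≤ π + 1 →
    c * Real.exp |z.re| ≤ ‖sinhDivDiv z‖ * (1 + |z.re|) ^ 2 := by
  have hp := Real.pi_gt_three
  have hK : IsCompact (Set.Icc (-1 : ℝ) 1 ×ℂ Set.Icc (0 : ℝ) (π + 1)) :=
    isCompact_Icc.reProdIm isCompact_Icc
  have hne : (Set.Icc (-1 : ℝ) 1 ×ℂ Set.Icc (0 : ℝ) (π + 1)).Nonempty :=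
    ⟨0, by simp [Complex.mem_reProdIm]; linarith⟩
  obtain ⟨w, hw, hmin⟩ := hK.exists_isMinOn hne
    (differentiable_sinhDivDiv.continuous.norm.continuousOn)
  have hw' : 0 ≤ w.im ∧ w.im ≤ π + 1 := (Complex.mem_reProdIm.mp hw).2
  have hm : 0 < ‖sinhDivDiv w‖ :=
    norm_pos_iff.mpr (sinhDivDiv_ne_zero (by linarith) (by linarith))
  refine ⟨min (‖sinhDivDiv w‖ * Real.exp (-1)) (1 / 100), by positivity, fun z h0 h1 => ?_⟩
  have ha := abs_nonneg z.re
  have he := Real.exp_pos |z.re|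
  rcases le_or_gt 1 |z.re| with h | h
  · have hs := exp_abs_re_le_norm_sinh h
    rw [← mul_sub_mul_sinhDivDiv, norm_mul, norm_mul] at hs
    have hz := norm_le_of_mem_strip h0 h1
    have hzp : ‖z - π * Complex.I‖ ≤ 5 * (1 + |z.re|) := by
      have h2 := Complex.norm_le_abs_re_add_abs_im (z - π * Complex.I)
      have h3 : |z.im - π| ≤ π := abs_le.mpr ⟨by linarith, by linarith⟩
      have := Real.pi_lt_four
      simp at h2
      linarith
    have h4 : ‖z‖ * ‖z - π * Complex.I‖ ≤ (5 * (1 + |z.re|)) * (5 * (1 + |z.re|)) := by gcongr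
    have h5 := mul_le_mul_of_nonneg_right h4 (norm_nonneg (sinhDivDiv z))
    have h6 := mul_le_mul_of_nonneg_right (min_le_right (‖sinhDivDiv w‖ * Real.exp (-1)) (1 / 100))
      he.le
    linarith
  · have hzK : z ∈ Set.Icc (-1 : ℝ) 1 ×ℂ Set.Icc (0 : ℝ) (π + 1) :=
      Complex.mem_reProdIm.mpr ⟨abs_le.mp h.le, h0, h1⟩
    have h2 : ‖sinhDivDiv w‖ ≤ ‖sinhDivDiv z‖ := hmin hzK
    have h3 : Real.exp (-1) * Real.exp |z.re| ≤ 1 := by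
      rw [← Real.exp_add]
      exact Real.exp_le_one_iff.mpr (by linarith)
    have h4 : (1 : ℝ) ≤ (1 + |z.re|) ^ 2 := by nlinarith
    calc min (‖sinhDivDiv w‖ * Real.exp (-1)) (1 / 100) * Real.exp |z.re|
        ≤ ‖sinhDivDiv w‖ * Real.exp (-1) * Real.exp |z.re| := by gcongr; exact min_le_left _ _
      _ = ‖sinhDivDiv w‖ * (Real.exp (-1) * Real.exp |z.re|) := by ring
      _ ≤ ‖sinhDivDiv z‖ * (1 + |z.re|) ^ 2 := by gcongr; exact h3.trans h4

theorem exists_one_add_pow_le_exp (m : ℕ) {δ : ℝ} (hδ : 0 < δ) :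
    ∃ C > 0, ∀ x : ℝ, 0 ≤ x → (1 + x) ^ m ≤ C * Real.exp (δ * x) := by
  refine ⟨m.factorial * Real.exp δ / δ ^ m, by positivity, fun x hx => ?_⟩
  have h := Real.pow_div_factorial_le_exp (δ * (1 + x)) (by positivity) m
  rw [div_le_iff₀ (by positivity), mul_pow, mul_add, mul_one, Real.exp_add] at h
  rw [div_mul_eq_mul_div, le_div_iff₀ (by positivity)]
  linarith

/-- The heat kernel integrand at `R = 0` without the oscillating factor, multiplied by
`(z - π i) ^ (n + k₁)`. -/
noncomputable def regularFactor (n k₁ k₂ : ℕ) (z : ℂ) : ℂ :=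
  z ^ k₂ * Complex.cosh z ^ k₁ * (sinhDivDiv z)⁻¹ ^ (n + k₁)

theorem exists_norm_regularFactor_le (n k₁ k₂ : ℕ) (hn : 1 ≤ n) : ∃ C > 0, ∀ z : ℂ,
    0 ≤ z.im → z.im ≤ π + 1 →
    ‖regularFactor n k₁ k₂ z‖ ≤ C * Real.exp (-(3 / 4) * |z.re|) := by
  obtain ⟨c, hc, hs⟩ := exists_le_norm_sinhDivDiv
  obtain ⟨B, hB, hpow⟩ := exists_one_add_pow_le_exp (k₂ + 2 * (n + k₁)) (δ := 1 / 4) (by norm_num)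
  refine ⟨5 ^ k₂ * c⁻¹ ^ (n + k₁) * B, by positivity, fun z h0 h1 => ?_⟩
  have hp := Real.pi_gt_three
  have ha := abs_nonneg z.re
  have hz := norm_le_of_mem_strip h0 h1
  have hsp : 0 < ‖sinhDivDiv z‖ :=
    norm_pos_iff.mpr (sinhDivDiv_ne_zero (by linarith) (by linarith))
  have hinv : ‖(sinhDivDiv z)⁻¹‖ ≤ c⁻¹ * ((1 + |z.re|) ^ 2 * Real.exp (-|z.re|)) := by
    rw [norm_inv, inv_le_iff_one_le_mul₀ hsp, Real.exp_neg]
    have := hs z h0 h1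
    have he := Real.exp_pos |z.re|
    field_simp
    linarith
  rw [regularFactor, norm_mul, norm_mul, norm_pow, norm_pow, norm_pow]
  calc ‖z‖ ^ k₂ * ‖Complex.cosh z‖ ^ k₁ * ‖(sinhDivDiv z)⁻¹‖ ^ (n + k₁)
      ≤ (5 * (1 + |z.re|)) ^ k₂ * Real.exp |z.re| ^ k₁ *
        (c⁻¹ * ((1 + |z.re|) ^ 2 * Real.exp (-|z.re|))) ^ (n + k₁) := by
        gcongr
        exact norm_complex_cosh_le z
    _ = 5 ^ k₂ * c⁻¹ ^ (n + k₁) * (1 + |z.re|) ^ (k₂ + 2 * (n + k₁)) *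
        Real.exp (-(n * |z.re|)) := by
        have e : Real.exp (-(n * |z.re|)) =
            Real.exp |z.re| ^ k₁ * Real.exp (-|z.re|) ^ (n + k₁) := by
          rw [← Real.exp_nat_mul, ← Real.exp_nat_mul, ← Real.exp_add]
          congr 1
          push_cast
          ring
        rw [e, mul_pow, mul_pow, mul_pow, pow_add (1 + |z.re|), pow_mul]
        ring
    _ ≤ 5 ^ k₂ * c⁻¹ ^ (n + k₁) * (B * Real.exp (1 / 4 * |z.re|)) * Real.exp (-|z.re|) := by
        have hn' : (1 : ℝ) ≤ n := by exact_mod_cast hn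
        have hn2 : |z.re| ≤ n * |z.re| := by nlinarith
        gcongr
        exact hpow _ ha
    _ = 5 ^ k₂ * c⁻¹ ^ (n + k₁) * B * Real.exp (-(3 / 4) * |z.re|) := by
        rw [show -(3 / 4) * |z.re| = 1 / 4 * |z.re| + -|z.re| by ring, Real.exp_add]
        ring

theorem exists_norm_cosh_div_sinhDivDiv_le : ∃ C > 0, ∀ z : ℂ, 0 ≤ z.im → z.im ≤ π + 1 →
    ‖Complex.cosh z / sinhDivDiv z‖ ≤ C * (1 + |z.re|) ^ 2 := by
  obtain ⟨c, hc, hs⟩ := exists_le_norm_sinhDivDiv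
  refine ⟨c⁻¹, by positivity, fun z h0 h1 => ?_⟩
  have hp := Real.pi_gt_three
  have hsp : 0 < ‖sinhDivDiv z‖ :=
    norm_pos_iff.mpr (sinhDivDiv_ne_zero (by linarith) (by linarith))
  rw [norm_div, div_le_iff₀ hsp, mul_assoc, mul_comm _ ‖sinhDivDiv z‖,
    le_inv_mul_iff₀ hc]
  refine le_trans ?_ (hs z h0 h1)
  gcongr
  exact norm_complex_cosh_le z

theorem differentiableAt_regularFactor (n k₁ k₂ : ℕ) {z : ℂ} (h1 : -π < z.im)
    (h2 : z.im < 2 * π) : DifferentiableAt ℂ (regularFactor n k₁ k₂) z := by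
  have hd := differentiable_sinhDivDiv z
  have hne := sinhDivDiv_ne_zero h1 h2
  unfold regularFactor
  fun_prop (disch := assumption)

/-- The contribution of the factor `exp (-R z coth z) - 1` to the heat kernel integrand. -/
noncomputable def radialCorrection (n k₁ k₂ : ℕ) (R : ℝ) (z : ℂ) : ℂ :=
  (Complex.exp (-R * (Complex.cosh z / sinhDivDiv z / (z - π * Complex.I))) - 1) *
    (regularFactor n k₁ k₂ z / (z - π * Complex.I) ^ (n + k₁))

theorem differentiableAt_radialCorrection (n k₁ k₂ : ℕ) (R : ℝ) {z : ℂ} (h1 : -π < z.im)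
    (h2 : z.im < π) : DifferentiableAt ℂ (radialCorrection n k₁ k₂ R) z := by
  have hp := Real.pi_pos
  have hd := differentiable_sinhDivDiv z
  have hr := differentiableAt_regularFactor n k₁ k₂ h1 (by linarith : z.im < 2 * π)
  have hne := sinhDivDiv_ne_zero h1 (by linarith)
  have hsub : z - π * Complex.I ≠ 0 := by
    intro h
    have := congrArg Complex.im h
    simp at this
    linarith
  have hpow : (z - π * Complex.I) ^ (n + k₁) ≠ 0 := pow_ne_zero _ hsub
  unfold radialCorrection
  fun_prop (disch := assumption)

theorem exists_norm_radialCorrection_le (n k₁ k₂ : ℕ) (hn : 1 ≤ n) : ∃ C > 0, ∃ ρ > 0,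
    ∀ T R : ℝ, 1 ≤ T → 0 ≤ R → R * T ≤ ρ → ∀ z : ℂ, 0 ≤ z.im → z.im ≤ π - 1 / T →
    ‖radialCorrection n k₁ k₂ R z‖ ≤
      C * R * Real.exp (-(1 / 4) * |z.re|) / ‖z - π * Complex.I‖ ^ (n + k₁ + 1) := by
  obtain ⟨C₁, hC₁, hq⟩ := exists_norm_cosh_div_sinhDivDiv_le
  obtain ⟨C₂, hC₂, hk⟩ := exists_norm_regularFactor_le n k₁ k₂ hn
  obtain ⟨B, hB, hpow⟩ := exists_one_add_pow_le_exp 2 (δ := 1 / 4) (by norm_num)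
  refine ⟨C₁ * B * Real.exp (3 / 4) * C₂, by positivity, 1 / (4 * C₁), by positivity,
    fun T R hT hR hRT z h0 h1 => ?_⟩
  have hT0 : 0 < T := by linarith
  have hTi : 0 < 1 / T := by positivity
  have ha := abs_nonneg z.re
  have h1' : z.im ≤ π + 1 := by linarith
  set r := ‖z - π * Complex.I‖ with hr
  have hr1 : 1 / T ≤ r := by
    have h2 := Complex.abs_im_le_norm (z - π * Complex.I)
    have h3 := neg_le_abs (z - π * Complex.I).im
    simp at h2 h3
    rw [one_div] at h1 ⊢
    linarith
  have hr2 : |z.re| ≤ r := by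
    have h2 := Complex.abs_re_le_norm (z - π * Complex.I)
    simpa using h2
  have hr0 : 0 < r := hTi.trans_le hr1
  set w := -R * (Complex.cosh z / sinhDivDiv z / (z - π * Complex.I)) with hw
  have hw1 : ‖w‖ ≤ R * (C₁ * (1 + |z.re|) ^ 2) / r := by
    rw [hw, norm_mul, norm_neg, Complex.norm_real, Real.norm_of_nonneg hR, norm_div, ← hr,
      ← mul_div_assoc]
    gcongr
    exact hq z h0 h1'
  have hw2 : ‖w‖ ≤ (3 + |z.re|) / 4 := by
    have hTr : 1 ≤ T * r := by
      rw [div_le_iff₀ hT0] at hr1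
      linarith
    have h5 : (1 + |z.re|) ^ 2 ≤ T * (3 + |z.re|) * r := by
      nlinarith [mul_le_mul_of_nonneg_left hr2 hT0.le, mul_le_mul_of_nonneg_right hr2 ha,
        mul_le_mul_of_nonneg_right hTr ha, mul_nonneg ha hr0.le,
        mul_nonneg (mul_nonneg ha hr0.le) (sub_nonneg.mpr hT)]
    refine hw1.trans ?_
    rw [div_le_iff₀ hr0]
    calc R * (C₁ * (1 + |z.re|) ^ 2) ≤ R * (C₁ * (T * (3 + |z.re|) * r)) := by gcongr
      _ = (R * T) * (C₁ * (3 + |z.re|) * r) := by ring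
      _ ≤ 1 / (4 * C₁) * (C₁ * (3 + |z.re|) * r) := by gcongr
      _ = (3 + |z.re|) / 4 * r := by
        field_simp
  have hexp : ‖Complex.exp w - 1‖ ≤ ‖w‖ * Real.exp ‖w‖ := by
    simpa using Complex.norm_exp_sub_sum_le_norm_mul_exp w 1
  rw [radialCorrection, ← hw, norm_mul, norm_div, norm_pow, ← hr]
  calc ‖Complex.exp w - 1‖ * (‖regularFactor n k₁ k₂ z‖ / r ^ (n + k₁))
      ≤ (R * (C₁ * (B * Real.exp (1 / 4 * |z.re|))) / r * Real.exp ((3 + |z.re|) / 4)) *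
        (C₂ * Real.exp (-(3 / 4) * |z.re|) / r ^ (n + k₁)) := by
        gcongr
        · refine hexp.trans ?_
          gcongr
          refine hw1.trans ?_
          gcongr
          exact hpow _ ha
        · exact hk z h0 h1'
    _ = C₁ * B * Real.exp (3 / 4) * C₂ * R * Real.exp (-(1 / 4) * |z.re|) /
        r ^ (n + k₁ + 1) := by
        have e : Real.exp (3 / 4) * Real.exp (-(1 / 4) * |z.re|) =
            Real.exp (1 / 4 * |z.re|) * Real.exp ((3 + |z.re|) / 4) *
              Real.exp (-(3 / 4) * |z.re|) := by
          rw [← Real.exp_add, ← Real.exp_add, ← Real.exp_add]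
          congr 1
          ring
        rw [pow_succ]
        linear_combination (-(C₁ * B * C₂ * R * r⁻¹ * (r ^ (n + k₁))⁻¹)) * e

theorem norm_cexp_I_mul_mul (z : ℂ) (T : ℝ) :
    ‖Complex.exp (Complex.I * z * T)‖ = Real.exp (-(z.im * T)) := by
  rw [Complex.norm_exp]
  simp

theorem exists_norm_integral_radialCorrection_le (n k₁ k₂ : ℕ) (hn : 1 ≤ n) :
    ∃ C > 0, ∃ ρ > 0, ∀ T R : ℝ, 1 ≤ T → 0 ≤ R → R * T ≤ ρ →
    Integrable (fun u : ℝ => Complex.exp (Complex.I * u * T) * radialCorrection n k₁ k₂ R u) ∧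
    ‖∫ u : ℝ, Complex.exp (Complex.I * u * T) * radialCorrection n k₁ k₂ R u‖ ≤
      C * (R * T) * T ^ (n + k₁ - 1) * Real.exp (-π * T) := by
  obtain ⟨C, hC, ρ, hρ, hbd⟩ := exists_norm_radialCorrection_le n k₁ k₂ hn
  obtain ⟨B, hB, hpow⟩ := exists_one_add_pow_le_exp 2 (δ := 1 / 4) (by norm_num)
  refine ⟨C * Real.exp 1 * π, by positivity, ρ, hρ, fun T R hT hR hRT => ?_⟩
  have hT0 : 0 < T := by linarith
  have hp3 := Real.pi_gt_three
  have hTi : 0 < 1 / T := by positivity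
  have hTi1 : 1 / T ≤ 1 := by rw [div_le_one hT0]; exact hT
  have hb : 0 ≤ π - 1 / T := by linarith
  set F : ℂ → ℂ := fun z => Complex.exp (Complex.I * z * T) * radialCorrection n k₁ k₂ R z
    with hF
  have hdist : ∀ z : ℂ, z.im ≤ π - 1 / T → 1 / T ≤ ‖z - π * Complex.I‖ := by
    intro z h1
    have h2 := Complex.abs_im_le_norm (z - π * Complex.I)
    have h3 := neg_le_abs (z - π * Complex.I).im
    simp at h2 h3
    rw [one_div] at h1 ⊢
    linarith
  have hdiff : DifferentiableOn ℂ F {z | 0 ≤ z.im ∧ z.im ≤ π - 1 / T} := by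
    intro z hz
    refine DifferentiableAt.differentiableWithinAt ?_
    refine DifferentiableAt.mul (by fun_prop) ?_
    exact differentiableAt_radialCorrection n k₁ k₂ R (by linarith [hz.1]) (by linarith [hz.2])
  have hdecay : ∀ z : ℂ, 0 ≤ z.im → z.im ≤ π - 1 / T →
      ‖F z‖ ≤ (C * R * T ^ (n + k₁ + 1) * B) * (1 + z.re ^ 2)⁻¹ := by
    intro z h0 h1
    have ha := abs_nonneg z.re
    have he : Real.exp (-(1 / 4) * |z.re|) ≤ B * (1 + z.re ^ 2)⁻¹ := by
      have h2 := hpow |z.re| ha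
      have h3 : 1 + z.re ^ 2 ≤ (1 + |z.re|) ^ 2 := by
        rw [← sq_abs z.re]
        nlinarith
      rw [neg_mul, Real.exp_neg, ← div_eq_mul_inv, le_div_iff₀ (by positivity),
        inv_mul_le_iff₀ (Real.exp_pos _)]
      linarith
    have hinv : (‖z - π * Complex.I‖ ^ (n + k₁ + 1))⁻¹ ≤ T ^ (n + k₁ + 1) := by
      rw [← inv_pow]
      gcongr
      rw [inv_le_comm₀ (hTi.trans_le (hdist z h1)) hT0, ← one_div]
      exact hdist z h1
    rw [hF]
    simp only
    rw [norm_mul, norm_cexp_I_mul_mul]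
    have hle : Real.exp (-(z.im * T)) ≤ 1 := Real.exp_le_one_iff.mpr (by nlinarith)
    calc Real.exp (-(z.im * T)) * ‖radialCorrection n k₁ k₂ R z‖
        ≤ 1 * ‖radialCorrection n k₁ k₂ R z‖ := by gcongr
      _ ≤ C * R * Real.exp (-(1 / 4) * |z.re|) / ‖z - π * Complex.I‖ ^ (n + k₁ + 1) := by
        rw [one_mul]
        exact hbd T R hT hR hRT z h0 h1
      _ ≤ C * R * (B * (1 + z.re ^ 2)⁻¹) * T ^ (n + k₁ + 1) := by
        rw [div_eq_mul_inv]
        gcongr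
      _ = _ := by ring
  constructor
  · refine (integrable_inv_one_add_sq.const_mul (C * R * T ^ (n + k₁ + 1) * B)).mono' ?_ ?_
    · refine Continuous.aestronglyMeasurable ?_
      exact hdiff.continuousOn.comp_continuous (f := fun u : ℝ => (u : ℂ)) (by fun_prop)
        (fun u => ⟨by simp, by simpa using hb⟩)
    · refine Filter.Eventually.of_forall fun u => ?_
      have := hdecay u (by simp) (by simpa using hb)
      rwa [Complex.ofReal_re] at this
  have hshift := integral_horizontal_line_eq hb hdiff hdecay
  change ‖∫ u : ℝ, F u‖ ≤ _
  rw [hshift]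
  have hline : ∀ u : ℝ, ‖F (u + (π - 1 / T : ℝ) * Complex.I)‖ ≤
      C * R * Real.exp (1 - π * T) * T ^ (n + k₁ + 1) * (1 + (T * u) ^ 2)⁻¹ := by
    intro u
    set z : ℂ := u + (π - 1 / T : ℝ) * Complex.I with hz
    have hre : z.re = u := by simp [hz]
    have him : z.im = π - 1 / T := by simp [hz]
    have h1 := hbd T R hT hR hRT z (by rw [him]; exact hb) him.le
    have hr1 := hdist z him.le
    have hr0 := hTi.trans_le hr1
    set r := ‖z - π * Complex.I‖ with hr
    have hsq : T ^ 2 * r ^ 2 = 1 + (T * u) ^ 2 := by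
      rw [hr, ← Complex.normSq_eq_norm_sq, Complex.normSq_apply]
      simp only [Complex.sub_re, Complex.sub_im, Complex.mul_re, Complex.mul_im, hre, him,
        Complex.I_re, Complex.I_im, Complex.ofReal_re, Complex.ofReal_im]
      field_simp
      ring
    have hinv : (r ^ (n + k₁ + 1))⁻¹ ≤ T ^ (n + k₁ + 1) * (1 + (T * u) ^ 2)⁻¹ := by
      have hTr : 1 ≤ T * r := by
        rw [div_le_iff₀ hT0] at hr1
        linarith
      rw [← hsq, ← div_eq_mul_inv, inv_le_comm₀ (by positivity) (by positivity), inv_div,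
        div_le_iff₀ (by positivity), ← mul_pow, ← mul_pow, mul_comm r T]
      exact pow_le_pow_right₀ hTr (by omega)
    rw [hF]
    simp only
    rw [norm_mul, norm_cexp_I_mul_mul, him]
    have e : -((π - 1 / T) * T) = 1 - π * T := by
      field_simp
      ring
    rw [e]
    have hle : Real.exp (-(1 / 4) * |z.re|) ≤ 1 := Real.exp_le_one_iff.mpr (by
      have := abs_nonneg z.re
      linarith)
    calc Real.exp (1 - π * T) * ‖radialCorrection n k₁ k₂ R z‖
        ≤ Real.exp (1 - π * T) * (C * R * 1 * (T ^ (n + k₁ + 1) * (1 + (T * u) ^ 2)⁻¹)) := by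
          gcongr
          refine h1.trans ?_
          rw [div_eq_mul_inv]
          gcongr
      _ = _ := by ring
  have hint : Integrable fun u : ℝ =>
      C * R * Real.exp (1 - π * T) * T ^ (n + k₁ + 1) * (1 + (T * u) ^ 2)⁻¹ :=
    (integrable_inv_one_add_sq.comp_mul_left' hT0.ne').const_mul _
  refine (norm_integral_le_of_norm_le hint (Filter.Eventually.of_forall hline)).trans_eq ?_
  rw [integral_const_mul, Measure.integral_comp_mul_left (fun u : ℝ => (1 + u ^ 2)⁻¹) T,
    integral_univ_inv_one_add_sq, abs_of_pos (by positivity), smul_eq_mul, sub_eq_add_neg,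
    Real.exp_add, ← neg_mul]
  obtain ⟨m, hm⟩ : ∃ m, n + k₁ = m + 1 := ⟨n + k₁ - 1, by omega⟩
  rw [hm, Nat.add_sub_cancel]
  field_simp
  ring

/-- Taylor expansion with holomorphic remainder. -/
theorem exists_taylor_remainder {k : ℂ → ℂ} {U : Set ℂ} {p : ℂ} (hU : U ∈ 𝓝 p)
    (hk : DifferentiableOn ℂ k U) (N : ℕ) : ∃ (c : ℕ → ℂ) (H : ℂ → ℂ), c 0 = k p ∧
    DifferentiableOn ℂ H U ∧
    ∀ z, k z = ∑ j ∈ Finset.range N, c j * (z - p) ^ j + (z - p) ^ N * H z := by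
  set G : ℕ → ℂ → ℂ := fun j => (fun g : ℂ → ℂ => dslope g p)^[j] k with hG
  have hsucc : ∀ j, G (j + 1) = dslope (G j) p := fun j => by
    rw [hG]
    exact Function.iterate_succ_apply' _ _ _
  refine ⟨fun j => G j p, G N, rfl, ?_, fun z => ?_⟩
  · induction N with
    | zero => exact hk
    | succ N ih =>
      rw [hsucc]
      exact (Complex.differentiableOn_dslope hU).mpr ih
  · induction N with
    | zero => simp [hG]
    | succ N ih =>
      have h := sub_smul_dslope (G N) p z
      rw [smul_eq_mul, ← hsucc] at h
      rw [ih, Finset.sum_range_succ]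
      linear_combination (-(z - p) ^ N) * h

theorem exists_norm_integral_polar_sub_le {k : ℂ → ℂ} {C : ℝ}
    (hk : DifferentiableOn ℂ k {z | -π < z.im ∧ z.im < 2 * π})
    (hC : ∀ z : ℂ, 0 ≤ z.im → z.im ≤ π + 1 → ‖k z‖ ≤ C * (1 + z.re ^ 2)⁻¹) (m : ℕ) :
    ∃ K > 0, ∀ T : ℝ, 1 ≤ T →
    ‖(∫ u : ℝ, Complex.exp (Complex.I * u * T) * (k u / (u - π * Complex.I) ^ (m + 1))) -
      2 * π * Complex.I ^ (m + 1) * k (π * Complex.I) * T ^ m * Real.exp (-π * T) / m.factorial‖ ≤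
      K * T ^ m * Real.exp (-π * T) * (1 / T) := by
  have hp3 := Real.pi_gt_three
  set U : Set ℂ := {z | -π < z.im ∧ z.im < 2 * π} with hU
  have hUo : IsOpen U := (isOpen_lt continuous_const Complex.continuous_im).inter
    (isOpen_lt Complex.continuous_im continuous_const)
  have hpU : U ∈ 𝓝 (π * Complex.I) := hUo.mem_nhds (by
    simp only [hU, Set.mem_ofPred_eq, Complex.mul_im, Complex.ofReal_re, Complex.I_im,
      Complex.ofReal_im, Complex.I_re]
    constructor <;> linarith)
  obtain ⟨c, H, hc0, hH, hkH⟩ := exists_taylor_remainder hpU hk (m + 1)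
  set a : ℕ → ℂ := fun j => c j * Complex.I ^ (m - j + 1) with ha
  set M : ℕ → ℂ → ℂ := fun j z => ((π : ℝ) + Complex.I * z)⁻¹ ^ (m - j + 1) -
    ((2 * π : ℝ) + Complex.I * z)⁻¹ ^ (m - j + 1) with hM
  set Ht : ℂ → ℂ := fun z => H z + ∑ j ∈ Finset.range (m + 1),
    a j * ((2 * π : ℝ) + Complex.I * z)⁻¹ ^ (m - j + 1) with hHt
  have hdecomp : ∀ z : ℂ, z ≠ π * Complex.I → k z / (z - π * Complex.I) ^ (m + 1) =
      ∑ j ∈ Finset.range (m + 1), a j * M j z + Ht z := by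
    intro z hz
    have hz' : z - π * Complex.I ≠ 0 := sub_ne_zero.mpr hz
    rw [hHt, hM]
    simp only [mul_sub, Finset.sum_sub_distrib]
    rw [add_comm (H z), ← add_assoc, sub_add_cancel, hkH z, add_div, mul_div_cancel_left₀ _
      (pow_ne_zero _ hz'), Finset.sum_div]
    congr 1
    refine Finset.sum_congr rfl fun j hj => ?_
    have hj' : j + (m - j + 1) = m + 1 := by
      have := Finset.mem_range.mp hj
      omega
    have e : ((π : ℝ) + Complex.I * z)⁻¹ = (-Complex.I) * (z - π * Complex.I)⁻¹ := by
      rw [show ((π : ℝ) + Complex.I * z : ℂ) = Complex.I * (z - π * Complex.I) by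
        linear_combination (π : ℂ) * Complex.I_sq, mul_inv, Complex.inv_I]
    rw [ha, e, ← hj', pow_add]
    simp only
    rw [mul_assoc, ← mul_pow, ← mul_assoc, mul_neg, Complex.I_mul_I, neg_neg, one_mul, inv_pow]
    field_simp
  have hHtd : DifferentiableOn ℂ Ht U := by
    refine hH.add (DifferentiableOn.fun_sum fun j _ => ?_)
    refine (DifferentiableOn.pow (DifferentiableOn.inv (by fun_prop) ?_) _).const_mul _
    intro z hz h
    have h1 := congrArg Complex.re h
    simp at h1
    have := hz.2
    linarith
  have hsub : ∀ z : ℂ, 0 ≤ z.im → z.im ≤ π + 1 → z ∈ U := fun z h0 h1 =>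
    ⟨by linarith, by linarith⟩
  obtain ⟨D, hD0, hD⟩ : ∃ D : ℝ, 0 ≤ D ∧ ∀ z : ℂ, 0 ≤ z.im → z.im ≤ π + 1 →
      ‖Ht z‖ ≤ D * (1 + z.re ^ 2)⁻¹ := by
    have hK : IsCompact (Set.Icc (-1 : ℝ) 1 ×ℂ Set.Icc (0 : ℝ) (π + 1)) :=
      isCompact_Icc.reProdIm isCompact_Icc
    obtain ⟨D₁, hD₁⟩ := hK.exists_bound_of_continuousOn (f := Ht)
      (hHtd.continuousOn.mono fun z hz =>
        hsub z (Complex.mem_reProdIm.mp hz).2.1 (Complex.mem_reProdIm.mp hz).2.2)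
    set S : ℝ := ∑ j ∈ Finset.range (m + 1), ‖a j‖ * ((m - j + 1 : ℕ) * π) with hS
    have hS0 : 0 ≤ S := Finset.sum_nonneg fun j _ => by positivity
    have hC0 : 0 ≤ C := by
      have := (norm_nonneg _).trans (hC 0 (by simp) (by simp; linarith))
      simpa using this
    have hD10 : 0 ≤ D₁ := (norm_nonneg _).trans (hD₁ 0 (Complex.mem_reProdIm.mpr
      (by simp; linarith)))
    refine ⟨2 * D₁ + (C + 2 * S), by positivity, fun z h0 h1 => ?_⟩
    rw [← div_eq_mul_inv, le_div_iff₀ (by positivity)]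
    rcases le_total 1 |z.re| with h | h
    · have hsq : 1 ≤ z.re ^ 2 := by
        rw [← sq_abs]
        nlinarith
      have hz' : |z.re| ≤ ‖z - π * Complex.I‖ := by
        simpa using Complex.abs_re_le_norm (z - π * Complex.I)
      have hzne : z ≠ π * Complex.I := by
        intro hz
        rw [hz] at h
        simp at h
        linarith
      have hx : |z.re| ≤ ‖((π : ℝ) + Complex.I * z : ℂ)‖ := by
        simpa using Complex.abs_im_le_norm ((π : ℝ) + Complex.I * z : ℂ)
      have hy : |z.re| ≤ ‖((2 * π : ℝ) + Complex.I * z : ℂ)‖ := by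
        simpa using Complex.abs_im_le_norm ((2 * π : ℝ) + Complex.I * z : ℂ)
      have hMb : ∀ j, ‖M j z‖ ≤ (m - j + 1 : ℕ) * (π * (z.re ^ 2)⁻¹) := by
        intro j
        have := norm_inv_pow_sub_inv_pow_le h hx hy (m - j + 1)
        rw [sq_abs, show ((2 * π : ℝ) + Complex.I * z : ℂ) - ((π : ℝ) + Complex.I * z) =
          ((π : ℝ) : ℂ) by push_cast; ring, Complex.norm_real,
          Real.norm_of_nonneg Real.pi_pos.le] at this
        exact this
      have hsum : ‖∑ j ∈ Finset.range (m + 1), a j * M j z‖ ≤ S * (z.re ^ 2)⁻¹ := by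
        rw [hS, Finset.sum_mul]
        refine (norm_sum_le _ _).trans (Finset.sum_le_sum fun j _ => ?_)
        rw [norm_mul, mul_assoc, mul_assoc]
        gcongr
        exact hMb j
      have hkb : ‖k z / (z - π * Complex.I) ^ (m + 1)‖ ≤ C * (1 + z.re ^ 2)⁻¹ := by
        rw [norm_div, norm_pow]
        refine (div_le_self (norm_nonneg _) (one_le_pow₀ (h.trans hz'))).trans (hC z h0 h1)
      have hHe : Ht z = k z / (z - π * Complex.I) ^ (m + 1) -
          ∑ j ∈ Finset.range (m + 1), a j * M j z := by
        rw [hdecomp z hzne]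
        ring
      have hHn : ‖Ht z‖ ≤ C * (1 + z.re ^ 2)⁻¹ + S * (z.re ^ 2)⁻¹ := by
        rw [hHe]
        exact (norm_sub_le _ _).trans (add_le_add hkb hsum)
      have h3 : (z.re ^ 2)⁻¹ * (1 + z.re ^ 2) ≤ 2 := by
        rw [inv_mul_le_iff₀ (by positivity)]
        linarith
      calc ‖Ht z‖ * (1 + z.re ^ 2)
          ≤ (C * (1 + z.re ^ 2)⁻¹ + S * (z.re ^ 2)⁻¹) * (1 + z.re ^ 2) := by gcongr
        _ = C + S * ((z.re ^ 2)⁻¹ * (1 + z.re ^ 2)) := by field_simp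
        _ ≤ 2 * D₁ + (C + 2 * S) := by nlinarith
    · have h2 := hD₁ z (Complex.mem_reProdIm.mpr ⟨abs_le.mp h, h0, h1⟩)
      have hsq : z.re ^ 2 ≤ 1 := by
        rw [← sq_abs]
        have := abs_nonneg z.re
        nlinarith
      nlinarith [norm_nonneg (Ht z)]
  set A : ℝ := ∑ j ∈ Finset.range m, ‖a (j + 1)‖ with hA
  have hA0 : 0 ≤ A := Finset.sum_nonneg fun j _ => norm_nonneg _
  refine ⟨2 * π * A + 2 * π * ‖a 0‖ + D * π + 1, by positivity, fun T hT => ?_⟩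
  have hT0 : 0 < T := by linarith
  set F : ℂ → ℂ := fun z => Complex.exp (Complex.I * z * T) * Ht z with hF
  have hFd : DifferentiableOn ℂ F {z | 0 ≤ z.im ∧ z.im ≤ π + 1} := by
    refine DifferentiableOn.mul (by fun_prop) (hHtd.mono fun z hz => hsub z hz.1 hz.2)
  have hFb' : ∀ z : ℂ, 0 ≤ z.im → z.im ≤ π + 1 →
      ‖F z‖ ≤ Real.exp (-(z.im * T)) * (D * (1 + z.re ^ 2)⁻¹) := by
    intro z h0 h1
    rw [hF]
    simp only
    rw [norm_mul, norm_cexp_I_mul_mul]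
    gcongr
    exact hD z h0 h1
  have hFb : ∀ z : ℂ, 0 ≤ z.im → z.im ≤ π + 1 → ‖F z‖ ≤ D * (1 + z.re ^ 2)⁻¹ := by
    intro z h0 h1
    refine (hFb' z h0 h1).trans (mul_le_of_le_one_left (by positivity) ?_)
    exact Real.exp_le_one_iff.mpr (by nlinarith)
  have hFi : Integrable fun u : ℝ => F u := by
    refine (integrable_inv_one_add_sq.const_mul D).mono' ?_ ?_
    · refine Continuous.aestronglyMeasurable ?_
      exact hFd.continuousOn.comp_continuous (f := fun u : ℝ => (u : ℂ)) (by fun_prop)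
        (fun u => ⟨by simp, by simp; linarith⟩)
    · refine Filter.Eventually.of_forall fun u => ?_
      have := hFb u (by simp) (by simp; linarith)
      rwa [Complex.ofReal_re] at this
  have hTe : Real.exp (-T) ≤ 1 / T := by
    rw [Real.exp_neg, ← one_div]
    have := Real.add_one_le_exp T
    gcongr
    linarith
  have hFint : ‖∫ u : ℝ, F u‖ ≤ D * π * (Real.exp (-π * T) * (1 / T)) := by
    rw [integral_horizontal_line_eq (by linarith) hFd hFb]
    have hline : ∀ u : ℝ, ‖F (u + (π + 1 : ℝ) * Complex.I)‖ ≤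
        Real.exp (-((π + 1) * T)) * D * (1 + u ^ 2)⁻¹ := by
      intro u
      have := hFb' (u + (π + 1 : ℝ) * Complex.I) (by simp; linarith) (by simp)
      simpa [mul_assoc] using this
    refine (norm_integral_le_of_norm_le (integrable_inv_one_add_sq.const_mul _)
      (Filter.Eventually.of_forall hline)).trans ?_
    rw [integral_const_mul, integral_univ_inv_one_add_sq]
    have e : Real.exp (-((π + 1) * T)) = Real.exp (-π * T) * Real.exp (-T) := by
      rw [← Real.exp_add]
      congr 1
      ring
    rw [e]
    calc Real.exp (-π * T) * Real.exp (-T) * D * π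
        ≤ Real.exp (-π * T) * (1 / T) * D * π := by gcongr
      _ = _ := by ring
  have hMi : ∀ j, Integrable fun u : ℝ => Complex.exp (Complex.I * u * T) * M j u := by
    intro j
    refine (integrable_inv_pow_sub_inv_pow (a := π) (b := 2 * π) (by linarith) (by linarith)
      (m - j + 1)).bdd_mul (c := 1) (by fun_prop) ?_
    refine Filter.Eventually.of_forall fun u => ?_
    rw [norm_cexp_I_mul_mul]
    simp
  have hMint : ∀ j, ∫ u : ℝ, Complex.exp (Complex.I * u * T) * M j u =
      2 * π * T ^ (m - j) * (Real.exp (-π * T) - Real.exp (-(2 * π) * T) : ℝ) /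
        (m - j).factorial := fun j =>
    integral_cexp_mul_inv_pow_sub_inv_pow (by linarith) (by linarith) hT0 (m - j)
  have hJ : (∫ u : ℝ, Complex.exp (Complex.I * u * T) * (k u / (u - π * Complex.I) ^ (m + 1))) =
      ∑ j ∈ Finset.range (m + 1), a j * (2 * π * T ^ (m - j) *
        (Real.exp (-π * T) - Real.exp (-(2 * π) * T) : ℝ) / (m - j).factorial) +
      ∫ u : ℝ, F u := by
    have e : ∀ u : ℝ, Complex.exp (Complex.I * u * T) * (k u / (u - π * Complex.I) ^ (m + 1)) =
        ∑ j ∈ Finset.range (m + 1), a j * (Complex.exp (Complex.I * u * T) * M j u) + F u := by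
      intro u
      rw [hdecomp u, mul_add, Finset.mul_sum, hF]
      · congr 1
        exact Finset.sum_congr rfl fun j _ => by ring
      · intro h
        have := congrArg Complex.im h
        simp at this
        linarith
    simp_rw [e]
    rw [integral_add (integrable_finsetSum _ fun j _ => (hMi j).const_mul _) hFi,
      integral_finsetSum _ fun j _ => (hMi j).const_mul _]
    congr 1
    refine Finset.sum_congr rfl fun j _ => ?_
    rw [integral_const_mul, hMint]
  set δ : ℝ := Real.exp (-π * T) - Real.exp (-(2 * π) * T) with hδ
  have hδ0 : 0 ≤ δ := sub_nonneg.mpr (Real.exp_le_exp.mpr (by nlinarith))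
  have hδ1 : δ ≤ Real.exp (-π * T) := by
    rw [hδ]
    linarith [Real.exp_pos (-(2 * π) * T)]
  have hfac : ∀ i : ℕ, (1 : ℝ) ≤ i.factorial := fun i => by exact_mod_cast i.factorial_pos
  have hnorm : ∀ (w : ℂ) (i l : ℕ) (x : ℝ), 0 ≤ x →
      ‖w * (2 * π * T ^ i * (x : ℂ) / l.factorial)‖ =
        ‖w‖ * (2 * π * T ^ i * x / l.factorial) := by
    intro w i l x hx
    rw [norm_mul, norm_div, norm_mul, norm_mul, norm_mul, norm_pow, Complex.norm_real,
      Complex.norm_real, Complex.norm_real, Complex.norm_ofNat, Complex.norm_natCast,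
      Real.norm_of_nonneg Real.pi_pos.le, Real.norm_of_nonneg hT0.le, Real.norm_of_nonneg hx]
  have hlow : ‖∑ j ∈ Finset.range m, a (j + 1) * (2 * π * T ^ (m - (j + 1)) *
      (δ : ℂ) / (m - (j + 1)).factorial)‖ ≤
      2 * π * A * (T ^ m * Real.exp (-π * T) * (1 / T)) := by
    rw [hA, Finset.mul_sum, Finset.sum_mul]
    refine (norm_sum_le _ _).trans (Finset.sum_le_sum fun j hj => ?_)
    have hpw : T ^ (m - (j + 1)) ≤ T ^ m * (1 / T) := by
      rw [mul_one_div, le_div_iff₀ hT0, ← pow_succ]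
      exact pow_le_pow_right₀ hT (by have := Finset.mem_range.mp hj; omega)
    rw [hnorm _ _ _ _ hδ0]
    calc ‖a (j + 1)‖ * (2 * π * T ^ (m - (j + 1)) * δ / (m - (j + 1)).factorial)
        ≤ ‖a (j + 1)‖ * (2 * π * T ^ (m - (j + 1)) * δ) := by
          gcongr
          exact div_le_self (by positivity) (hfac _)
      _ ≤ ‖a (j + 1)‖ * (2 * π * (T ^ m * (1 / T)) * Real.exp (-π * T)) := by gcongr
      _ = _ := by ring
  have hlead : ‖a 0 * (2 * π * T ^ m * (δ : ℂ) / m.factorial) -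
      2 * π * Complex.I ^ (m + 1) * k (π * Complex.I) * T ^ m * Real.exp (-π * T) /
        m.factorial‖ ≤ 2 * π * ‖a 0‖ * (T ^ m * Real.exp (-π * T) * (1 / T)) := by
    have e : a 0 * (2 * π * T ^ m * (δ : ℂ) / m.factorial) -
        2 * π * Complex.I ^ (m + 1) * k (π * Complex.I) * T ^ m * Real.exp (-π * T) /
        m.factorial = -(a 0 * (2 * π * T ^ m * (Real.exp (-(2 * π) * T) : ℝ) / m.factorial)) := by
      rw [ha, ← hc0, hδ]
      simp only [Nat.sub_zero]
      rw [Complex.ofReal_sub]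
      ring
    rw [e, norm_neg, hnorm _ _ _ _ (Real.exp_pos _).le]
    have e2 : Real.exp (-(2 * π) * T) ≤ Real.exp (-π * T) * (1 / T) := by
      refine le_trans ?_ (mul_le_mul_of_nonneg_left hTe (Real.exp_pos _).le)
      rw [← Real.exp_add]
      exact Real.exp_le_exp.mpr (by nlinarith)
    calc ‖a 0‖ * (2 * π * T ^ m * Real.exp (-(2 * π) * T) / m.factorial)
        ≤ ‖a 0‖ * (2 * π * T ^ m * Real.exp (-(2 * π) * T)) := by
          gcongr
          exact div_le_self (by positivity) (hfac _)
      _ ≤ ‖a 0‖ * (2 * π * T ^ m * (Real.exp (-π * T) * (1 / T))) := by gcongr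
      _ = _ := by ring
  rw [hJ, Finset.sum_range_succ', Nat.sub_zero, add_assoc, add_sub_assoc, add_sub_right_comm]
  refine (norm_add_le _ _).trans ((add_le_add hlow (norm_add_le _ _)).trans ?_)
  refine (add_le_add_right (add_le_add hlead hFint) _).trans ?_
  have hTm : 1 ≤ T ^ m := one_le_pow₀ hT
  have hX : Real.exp (-π * T) * (1 / T) ≤ T ^ m * Real.exp (-π * T) * (1 / T) := by
    rw [mul_assoc]
    exact le_mul_of_one_le_left (by positivity) hTm
  have hX0 : 0 ≤ T ^ m * Real.exp (-π * T) * (1 / T) := by positivity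
  have := mul_le_mul_of_nonneg_left hX (by positivity : 0 ≤ D * π)
  nlinarith

/-- Compares the squared distance with its value `4πT` on the centre: if `θ(y) = T/R`, then
`R (y / sin y)²` differs from `πT` by at most a multiple of `√(TR)`. -/
theorem pi_mul_sub_distance_bounds {R T y : ℝ} (hR : 0 < R) (hT : 0 < T) (hRT : 2 * R ≤ T)
    (hy0 : 0 ≤ y) (hyπ : y < π) (hθ : theta y = T / R) :
    0 ≤ π * T - R * (y / Real.sin y) ^ 2 ∧
      π * T - R * (y / Real.sin y) ^ 2 ≤ π ^ 3 / 2 * √(T * R) := by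
  have hp3 := Real.pi_gt_three
  have hp4 := Real.pi_lt_four
  have hratio : 2 ≤ T / R := (le_div_iff₀ hR).mpr hRT
  have hyne : y ≠ 0 := by
    rintro rfl
    rw [theta, if_pos rfl] at hθ
    linarith
  have hy : 0 < y := lt_of_le_of_ne hy0 (Ne.symm hyne)
  have hs : 0 < Real.sin y := Real.sin_pos_of_pos_of_lt_pi hy hyπ
  rw [theta, if_neg hyne, Real.sin_two_mul, div_eq_div_iff (by positivity) hR.ne'] at hθ
  have hTs : T * Real.sin y ^ 2 = R * (y - Real.sin y * Real.cos y) := by linarith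
  have hyhalf : π / 2 < y := by
    by_contra! hle
    have htan : y * Real.cos y ≤ Real.sin y := by
      rcases hle.lt_or_eq with hlt | heq
      · have hc : 0 < Real.cos y := Real.cos_pos_of_mem_Ioo ⟨by linarith, hlt⟩
        have := Real.lt_tan hy hlt
        rw [Real.tan_eq_sin_div_cos, lt_div_iff₀ hc] at this
        exact this.le
      · rw [heq, Real.cos_pi_div_two, Real.sin_pi_div_two]
        linarith
    have h1 : y - Real.sin y * Real.cos y ≤ y * Real.sin y ^ 2 := by
      have hc : 0 ≤ Real.cos y := Real.cos_nonneg_of_mem_Icc ⟨by linarith, hle⟩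
      have := Real.sin_sq_add_cos_sq y
      nlinarith [mul_le_mul_of_nonneg_right htan hc]
    have h2 : T * Real.sin y ^ 2 ≤ R * y * Real.sin y ^ 2 := by
      rw [hTs, mul_assoc]
      gcongr
    have h3 : T ≤ R * y := le_of_mul_le_mul_right h2 (by positivity)
    nlinarith
  obtain ⟨ε, rfl⟩ : ∃ ε, y = π - ε := ⟨π - y, by ring⟩
  have hε : 0 < ε := by linarith
  have hε2 : ε < π / 2 := by linarith
  rw [Real.sin_pi_sub] at hs hTs ⊢
  rw [Real.cos_pi_sub] at hTs
  have hc : 0 ≤ Real.cos ε := Real.cos_nonneg_of_mem_Icc ⟨by linarith, hε2.le⟩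
  have hc1 : Real.cos ε ≤ 1 := Real.cos_le_one ε
  have hsle : Real.sin ε ≤ ε := Real.sin_le hε.le
  have hsge : 2 / π * ε ≤ Real.sin ε := Real.mul_le_sin hε.le hε2.le
  have hdiff : π * T - R * ((π - ε) / Real.sin ε) ^ 2 =
      R * ((π - ε) * ε + π * (Real.sin ε * Real.cos ε)) / Real.sin ε ^ 2 := by
    rw [eq_div_iff (by positivity)]
    field_simp
    linear_combination π * hTs
  have hsc : Real.sin ε * Real.cos ε ≤ ε := by nlinarith
  have hsc0 : 0 ≤ Real.sin ε * Real.cos ε := by positivity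
  constructor
  · rw [hdiff]
    have : 0 ≤ (π - ε) * ε := mul_nonneg (by linarith) hε.le
    positivity
  · have hup : π * T - R * ((π - ε) / Real.sin ε) ^ 2 ≤ π ^ 3 / 2 * (R / ε) := by
      rw [hdiff]
      have h2 : (π - ε) * ε + π * (Real.sin ε * Real.cos ε) ≤ 2 * π * ε := by nlinarith
      calc R * ((π - ε) * ε + π * (Real.sin ε * Real.cos ε)) / Real.sin ε ^ 2
          ≤ R * (2 * π * ε) / (2 / π * ε) ^ 2 := by gcongr
        _ = _ := by field_simp
    refine hup.trans ?_
    gcongr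
    refine Real.le_sqrt_of_sq_le ?_
    have h4 : R ≤ T * ε ^ 2 := by
      calc R ≤ R * (π - ε - Real.sin ε * -Real.cos ε) := by nlinarith
        _ = T * Real.sin ε ^ 2 := hTs.symm
        _ ≤ T * ε ^ 2 := by gcongr
    rw [div_pow, div_le_iff₀ (by positivity)]
    nlinarith

theorem exists_norm_regularFactor_le_inv_one_add_sq (n k₁ k₂ : ℕ) (hn : 1 ≤ n) : ∃ C > 0,
    ∀ z : ℂ, 0 ≤ z.im → z.im ≤ π + 1 →
      ‖regularFactor n k₁ k₂ z‖ ≤ C * (1 + z.re ^ 2)⁻¹ := by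
  obtain ⟨C, hC, hbd⟩ := exists_norm_regularFactor_le n k₁ k₂ hn
  obtain ⟨B, hB, hpow⟩ := exists_one_add_pow_le_exp 2 (δ := 3 / 4) (by norm_num)
  refine ⟨C * B, by positivity, fun z h0 h1 => (hbd z h0 h1).trans ?_⟩
  have ha := abs_nonneg z.re
  rw [mul_assoc]
  gcongr
  have h2 := hpow |z.re| ha
  have h3 : 1 + z.re ^ 2 ≤ (1 + |z.re|) ^ 2 := by
    rw [← sq_abs z.re]
    nlinarith
  rw [neg_mul, Real.exp_neg, ← div_eq_mul_inv, le_div_iff₀ (by positivity),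
    inv_mul_le_iff₀ (Real.exp_pos _)]
  linarith

theorem ofReal_sub_pi_mul_I_ne_zero (u : ℝ) : (u - π * Complex.I : ℂ) ≠ 0 := by
  intro h
  have := congrArg Complex.im h
  simp [Real.pi_ne_zero] at this

theorem integrable_cexp_mul_regularFactor_div (n k₁ k₂ : ℕ) (hn : 1 ≤ n) (T : ℝ) :
    Integrable fun u : ℝ => Complex.exp (Complex.I * u * T) *
      (regularFactor n k₁ k₂ u / (u - π * Complex.I) ^ (n + k₁)) := by
  obtain ⟨C, hC, hbd⟩ := exists_norm_regularFactor_le_inv_one_add_sq n k₁ k₂ hn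
  have hp3 := Real.pi_gt_three
  refine (integrable_inv_one_add_sq.const_mul C).mono' ?_ (Eventually.of_forall fun u => ?_)
  · refine Continuous.aestronglyMeasurable ?_
    have hr : Continuous fun u : ℝ => regularFactor n k₁ k₂ u := by
      refine continuous_iff_continuousAt.mpr fun u => ?_
      exact ContinuousAt.comp (f := fun u : ℝ => (u : ℂ))
        (differentiableAt_regularFactor n k₁ k₂ (by simp [Real.pi_pos])
          (by simp [Real.pi_pos])).continuousAt (by fun_prop)
    refine Continuous.mul (by fun_prop) (hr.div (by fun_prop) fun u => ?_)
    exact pow_ne_zero _ (ofReal_sub_pi_mul_I_ne_zero u)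
  · have h1 : (1 : ℝ) ≤ ‖(u - π * Complex.I : ℂ)‖ := by
      have h2 := Complex.abs_im_le_norm (u - π * Complex.I)
      have h3 := neg_le_abs (u - π * Complex.I : ℂ).im
      simp at h2 h3
      linarith
    have h4 := hbd u (by simp) (by simp; linarith)
    rw [Complex.ofReal_re] at h4
    rw [norm_mul, norm_cexp_I_mul_mul, norm_div, norm_pow, Complex.ofReal_im, zero_mul, neg_zero,
      Real.exp_zero, one_mul]
    exact (div_le_self (norm_nonneg _) (one_le_pow₀ h1)).trans h4

theorem heat_integrand_eq (n k₁ k₂ : ℕ) (R T : ℝ) {u : ℝ} (hu : u ≠ 0) :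
    Complex.exp (Complex.I * (u : ℂ) * T
        - ((R * u * Real.cosh u / Real.sinh u : ℝ) : ℂ)) *
      ((u : ℂ) ^ (n + k₁ + k₂) * ((Real.cosh u : ℝ) : ℂ) ^ k₁
        / ((Real.sinh u : ℝ) : ℂ) ^ (n + k₁)) =
      Complex.exp (Complex.I * u * T) * radialCorrection n k₁ k₂ R u +
        Complex.exp (Complex.I * u * T) *
          (regularFactor n k₁ k₂ u / (u - π * Complex.I) ^ (n + k₁)) := by
  have hsub := ofReal_sub_pi_mul_I_ne_zero u
  have hS : sinhDivDiv u ≠ 0 :=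
    sinhDivDiv_ne_zero (by simp [Real.pi_pos]) (by simp [Real.pi_pos])
  have hu' : (u : ℂ) ≠ 0 := by exact_mod_cast hu
  have hexp : ((R * u * Real.cosh u / Real.sinh u : ℝ) : ℂ) =
      R * (Complex.cosh u / sinhDivDiv u / (u - π * Complex.I)) := by
    rw [Complex.ofReal_div, Complex.ofReal_mul, Complex.ofReal_mul, Complex.ofReal_cosh,
      Complex.ofReal_sinh, ← mul_sub_mul_sinhDivDiv]
    field_simp
  have hpow : ((u : ℂ) ^ (n + k₁ + k₂) * ((Real.cosh u : ℝ) : ℂ) ^ k₁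
      / ((Real.sinh u : ℝ) : ℂ) ^ (n + k₁)) =
      regularFactor n k₁ k₂ u / (u - π * Complex.I) ^ (n + k₁) := by
    rw [Complex.ofReal_cosh, Complex.ofReal_sinh, ← mul_sub_mul_sinhDivDiv, regularFactor,
      mul_pow, mul_pow, inv_pow, pow_add _ (n + k₁) k₂]
    field_simp
  rw [hexp, hpow, radialCorrection, sub_eq_add_neg, Complex.exp_add, neg_mul]
  ring

theorem pH_eq_add (n k₁ k₂ : ℕ) (x : EuclideanSpace ℝ (Fin (2 * n))) (t : ℝ) (hn : 1 ≤ n)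
    (hint : Integrable fun u : ℝ => Complex.exp (Complex.I * u * (|t| : ℝ)) *
      radialCorrection n k₁ k₂ (‖x‖ ^ 2 / 4) u) :
    pH n k₁ k₂ x t = 2 * (-1 : ℂ) ^ k₁ * Complex.I ^ k₂ / (4 * (π : ℂ)) ^ (n + 1) *
      ((∫ u : ℝ, Complex.exp (Complex.I * u * (|t| : ℝ)) *
          radialCorrection n k₁ k₂ (‖x‖ ^ 2 / 4) u) +
        ∫ u : ℝ, Complex.exp (Complex.I * u * (|t| : ℝ)) *
          (regularFactor n k₁ k₂ u / (u - π * Complex.I) ^ (n + k₁))) := by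
  rw [pH, ← integral_add hint (integrable_cexp_mul_regularFactor_div n k₁ k₂ hn |t|)]
  congr 1
  refine integral_congr_ae ?_
  filter_upwards [Measure.ae_ne volume (0 : ℝ)] with u hu
  rw [if_neg hu]
  exact heat_integrand_eq n k₁ k₂ _ _ hu

theorem leading_coefficient_eq (n k₁ k₂ : ℕ) {m : ℕ} (hm : n + k₁ = m + 1) (T E : ℝ) :
    2 * (-1 : ℂ) ^ k₁ * Complex.I ^ k₂ / (4 * (π : ℂ)) ^ (n + 1) *
      (2 * π * Complex.I ^ (m + 1) * regularFactor n k₁ k₂ (π * Complex.I) * T ^ m * E /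
        m.factorial) =
      (((-1 : ℝ) ^ k₂ * π ^ (k₁ + k₂) / (4 ^ n * m.factorial) * T ^ m * E : ℝ) : ℂ) := by
  have hπ : (π : ℂ) ≠ 0 := by exact_mod_cast Real.pi_ne_zero
  have hf : (m.factorial : ℂ) ≠ 0 := by exact_mod_cast m.factorial_ne_zero
  have hII : ∀ j : ℕ, Complex.I ^ j * Complex.I ^ j = (-1) ^ j := fun j => by
    rw [← mul_pow, Complex.I_mul_I]
  have hone : ((-1 : ℂ) ^ k₁) * (-1) ^ k₁ = 1 := by
    rw [← mul_pow]
    norm_num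
  rw [regularFactor, sinhDivDiv_pi_mul_I, Complex.cosh_mul_I, ← Complex.ofReal_cos, Real.cos_pi,
    inv_div, ← hm, div_pow, mul_pow _ Complex.I]
  push_cast
  rw [show (2 : ℂ) * (-1) ^ k₁ * Complex.I ^ k₂ / (4 * π) ^ (n + 1) *
      (2 * π * Complex.I ^ (n + k₁) * (π ^ k₂ * Complex.I ^ k₂ * (-1) ^ k₁ *
        (π ^ (n + k₁) / Complex.I ^ (n + k₁))) * T ^ m * E / m.factorial) =
      4 * ((-1) ^ k₁ * (-1) ^ k₁) * (Complex.I ^ k₂ * Complex.I ^ k₂) * (π * π ^ k₂ *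
        π ^ (n + k₁)) / (4 * π) ^ (n + 1) * T ^ m * E / m.factorial by
    field_simp
    ring, hone, hII, mul_pow, pow_add, pow_add, pow_add, pow_add]
  field_simp

theorem abs_exp_neg_sub_exp_neg_le {a b : ℝ} (h : b ≤ a) :
    |Real.exp (-a) - Real.exp (-b)| ≤ Real.exp (-b) * (a - b) := by
  have h1 : Real.exp (-a) = Real.exp (-b) * Real.exp (-(a - b)) := by
    rw [← Real.exp_add]
    congr 1
    ring
  have h2 := Real.add_one_le_exp (-(a - b))
  have h3 : Real.exp (-a) ≤ Real.exp (-b) := Real.exp_le_exp.mpr (by linarith)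
  rw [abs_sub_comm, abs_of_nonneg (by linarith), h1]
  nlinarith [Real.exp_pos (-b)]

/-- Case IV asymptotics on the Heisenberg group: for κ → 0⁺ and |t| → +∞,
p_{1,k₁,k₂}(x,t) = ((−1)^{k₂}π^{k₁+k₂}/(4ⁿ(n+k₁−1)!)) |t|^{n+k₁−1} e^{−d²/4}[1 + O(1/|t| + κ)]. -/
theorem heisenberg_caseIV (n k₁ k₂ : ℕ) (hn : 1 ≤ n) :
    ∃ K : ℝ, 0 < K ∧ ∃ κ₀ : ℝ, 0 < κ₀ ∧ ∃ T₀ : ℝ, 0 < T₀ ∧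
      ∀ (x : EuclideanSpace ℝ (Fin (2 * n))) (t : ℝ) (yω κ d P : ℝ),
        t ≠ 0 →
        yω ∈ Set.Ico 0 π → (x ≠ 0 → theta yω = 4 * |t| / ‖x‖ ^ 2) →
        κ = (if x = 0 then 0 else 2 * Real.sqrt (π * |t| * (‖x‖ ^ 2 / 4))) →
        d = (if x = 0 then Real.sqrt (4 * π * |t|) else ‖x‖ * yω / Real.sin yω) →
        P = ((-1 : ℝ) ^ k₂ * π ^ (k₁ + k₂) / (4 ^ n * (Nat.factorial (n + k₁ - 1)))) *
            |t| ^ (n + k₁ - 1) * Real.exp (-d ^ 2 / 4) →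
        κ ≤ κ₀ → T₀ ≤ |t| →
        ‖pH n k₁ k₂ x t - (P : ℂ)‖ ≤ K * |P| * (1 / |t| + κ) := by
  obtain ⟨C₁, hC₁, ρ, hρ, hcorr⟩ := exists_norm_integral_radialCorrection_le n k₁ k₂ hn
  obtain ⟨m, hm⟩ : ∃ m, n + k₁ = m + 1 := ⟨n + k₁ - 1, by omega⟩
  obtain ⟨C₂, -, hreg⟩ := exists_norm_regularFactor_le_inv_one_add_sq n k₁ k₂ hn
  obtain ⟨K₁, hK₁, hpolar⟩ := exists_norm_integral_polar_sub_le
    (fun z hz => (differentiableAt_regularFactor n k₁ k₂ hz.1 hz.2).differentiableWithinAt) hreg m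
  set C₀ : ℂ := 2 * (-1 : ℂ) ^ k₁ * Complex.I ^ k₂ / (4 * (π : ℂ)) ^ (n + 1) with hC₀
  set c : ℝ := (-1 : ℝ) ^ k₂ * π ^ (k₁ + k₂) / (4 ^ n * m.factorial) with hc
  have hc0 : 0 < |c| := by
    rw [abs_pos, hc]
    have := m.factorial_ne_zero
    positivity
  refine ⟨‖C₀‖ * (C₁ + K₁) / |c| + π ^ 3 / 2, by positivity, min 1 ρ, by positivity, 1, one_pos,
    fun x t y κ d P ht hy hθ hκ hd hP hκ₀ hT => ?_⟩
  rw [hm, Nat.add_sub_cancel] at hP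
  have hp3 := Real.pi_gt_three
  set T := |t| with hTdef
  set R := ‖x‖ ^ 2 / 4 with hR
  have hT0 : 0 < T := by linarith
  have hR0 : 0 ≤ R := by positivity
  have hκ1 : κ ≤ 1 := hκ₀.trans (min_le_left _ _)
  obtain ⟨hκ0, hRT, hD0, hD1⟩ : 0 ≤ κ ∧ R * T ≤ κ ∧ d ^ 2 / 4 ≤ π * T ∧
      π * T - d ^ 2 / 4 ≤ π ^ 3 / 2 * κ := by
    by_cases hx : x = 0
    · rw [if_pos hx] at hκ hd
      rw [hd, Real.sq_sqrt (by positivity), hκ, hR, hx, norm_zero]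
      refine ⟨le_rfl, by simp, by linarith, by linarith⟩
    · rw [if_neg hx] at hκ hd
      have hR1 : 0 < R := by
        have := norm_pos_iff.mpr hx
        positivity
      have hκ0 : 0 ≤ κ := by
        rw [hκ]
        positivity
      have hκsq : κ ^ 2 = 4 * π * (R * T) := by
        rw [hκ, mul_pow, Real.sq_sqrt (by positivity)]
        ring
      have hRT0 : 0 < R * T := by positivity
      have hRT1 : R * T ≤ κ ^ 2 := by nlinarith
      have h2RT : 2 * R ≤ T := by nlinarith
      have hθ' : theta y = T / R := by
        rw [hθ hx, hR, div_div_eq_mul_div, mul_comm]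
      have hdR : d ^ 2 / 4 = R * (y / Real.sin y) ^ 2 := by
        rw [hd, hR]
        ring
      obtain ⟨h1, h2⟩ := pi_mul_sub_distance_bounds hR1 hT0 h2RT hy.1 hy.2 hθ'
      have hsqrt : √(T * R) ≤ κ := Real.sqrt_le_iff.mpr ⟨hκ0, by linarith⟩
      rw [hdR]
      refine ⟨hκ0, by nlinarith, by linarith, h2.trans (by gcongr)⟩
  obtain ⟨hint, hJ₁⟩ := hcorr T R hT hR0 (hRT.trans (hκ₀.trans (min_le_right _ _)))
  have hJ₂ := hpolar T hT
  rw [hm, Nat.add_sub_cancel] at hJ₁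
  rw [pH_eq_add n k₁ k₂ x t hn hint, ← hC₀]
  set J₁ := ∫ u : ℝ, Complex.exp (Complex.I * u * (T : ℝ)) * radialCorrection n k₁ k₂ R u
  have hlead := leading_coefficient_eq n k₁ k₂ hm T (Real.exp (-π * T))
  rw [← hC₀, ← hc] at hlead
  rw [hm]
  set J₂ := ∫ u : ℝ, Complex.exp (Complex.I * u * (T : ℝ)) *
    (regularFactor n k₁ k₂ u / (u - π * Complex.I) ^ (m + 1))
  set L : ℂ := 2 * π * Complex.I ^ (m + 1) * regularFactor n k₁ k₂ (π * Complex.I) * T ^ m *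
    Real.exp (-π * T) / m.factorial
  set E := Real.exp (-(d ^ 2 / 4)) with hE
  have hE0 : 0 < E := Real.exp_pos _
  have hEE : Real.exp (-π * T) ≤ E := Real.exp_le_exp.mpr (by linarith)
  have hPE : P = c * T ^ m * E := by rw [hP, hE, neg_div]
  have habs : |P| = |c| * T ^ m * E := by
    rw [hPE, abs_mul, abs_mul, abs_of_pos hE0, abs_of_pos (pow_pos hT0 m)]
  have hdiff : ‖((c * T ^ m * Real.exp (-π * T) : ℝ) : ℂ) - P‖ ≤ |P| * (π ^ 3 / 2 * κ) := by
    rw [← Complex.ofReal_sub, Complex.norm_real, hPE, ← mul_sub, norm_mul, ← hPE, habs,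
      Real.norm_eq_abs, Real.norm_eq_abs, abs_mul, abs_of_pos (pow_pos hT0 m), mul_assoc _ E]
    gcongr
    have := abs_exp_neg_sub_exp_neg_le hD0
    rw [← neg_mul] at this
    exact this.trans (by gcongr)
  have hsplit : C₀ * (J₁ + J₂) - P = C₀ * J₁ + C₀ * (J₂ - L) +
      (((c * T ^ m * Real.exp (-π * T) : ℝ) : ℂ) - P) := by
    rw [← hlead]
    ring
  rw [hsplit]
  calc ‖C₀ * J₁ + C₀ * (J₂ - L) + (((c * T ^ m * Real.exp (-π * T) : ℝ) : ℂ) - P)‖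
      ≤ ‖C₀‖ * ‖J₁‖ + ‖C₀‖ * ‖J₂ - L‖ + |P| * (π ^ 3 / 2 * κ) := by
        refine norm_add₃_le.trans ?_
        rw [norm_mul, norm_mul]
        gcongr
    _ ≤ ‖C₀‖ * (C₁ * κ * T ^ m * E) + ‖C₀‖ * (K₁ * T ^ m * E * (1 / T)) +
        |P| * (π ^ 3 / 2 * κ) := by
        gcongr
        · refine hJ₁.trans ?_
          gcongr
        · refine hJ₂.trans ?_
          gcongr
    _ ≤ ‖C₀‖ * ((C₁ + K₁) * T ^ m * E * (1 / T + κ)) + |P| * (π ^ 3 / 2 * (1 / T + κ)) := by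
        have h1 : 0 ≤ 1 / T := by positivity
        have h2 : C₁ * κ * T ^ m * E + K₁ * T ^ m * E * (1 / T) ≤
            (C₁ + K₁) * T ^ m * E * (1 / T + κ) := by
          have h3 : 0 ≤ T ^ m * E * (C₁ * (1 / T) + K₁ * κ) := by positivity
          linarith
        rw [← mul_add]
        gcongr
        linarith
    _ = _ := by
        rw [habs]
        field_simp
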